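/- Let S⁰ be an inverse semigroup with semilattice of idempotents E⁰, and let I be a left normal band containing E⁰ as a subsemigroup and as a semilattice transversal, with e ↦ e⁰ the transversal map. Let T = {(e,x) ∈ I × S⁰ : e⁰ = xx⁻¹} with multiplication (e,x)(g,w) = (e(aa⁻¹), a), where a = x((x⁻¹x)g)w ∈ S⁰. Then T is a left inverse semigroup and T⁰ = {(aa⁻¹, a) : a ∈ S⁰} is a quasi-ideal inverse transversal of T isomorphic to S⁰. Moreover, every left inverse semigroup with a quasi-ideal inverse transversal is isomorphic to one constructed in this way. -/

import Mathlib

/-!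
Common framework: "relative" semigroup-theoretic notions.  All notions are taken
relative to a carrier set `U` inside an ambient type, together with an explicit
binary operation `mul` (only the values of `mul` on `U` are relevant).  For an
honest semigroup `S` one takes `U = Set.univ` and `mul = mulOf S`.

* `RStarOn mul U a b` : the relation `a ℛ* b` computed in `U` with an identity
  adjoined (the two clauses correspond to multipliers from `U` and to the
  adjoined identity).
* `LStarOn`, `GreenLOn`, `GreenROn` : dual / Green's relations.
* `AbundantOn`, `AdequateOn`, `LeftAdequateOn`, `RightAdequateOn`.
* `AdequateTransversalOn mul U S0` : `S0` is an adequate `*`-subsemigroup of `U`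
  which is an adequate transversal, with the data `bar x = x̄`, `e x = e_x`,
  `f x = f_x`, and `plus s = s⁺`, `star s = s⋆` for `s ∈ S0`.
* `InverseTransversalOn mul U S0` : `S0` is an inverse transversal of the
  regular semigroup `U`, with `o x = x⁰` the unique inverse of `x` in `S0`.
-/

namespace Paper

universe u

variable {α : Type*} {β : Type*} {γ : Type*}

def mulOf (α : Type*) [Mul α] : α → α → α := fun a b => a * b

/-- `x` is an idempotent for the operation `mul`. -/
def Idem (mul : α → α → α) (x : α) : Prop := mul x x = x

/-- The relation `ℛ*` on `U` (with an identity adjoined to `U`). -/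
def RStarOn (mul : α → α → α) (U : Set α) (a b : α) : Prop :=
  (∀ x ∈ U, ∀ y ∈ U, (mul x a = mul y a ↔ mul x b = mul y b)) ∧
  (∀ x ∈ U, (mul x a = a ↔ mul x b = b))

/-- The relation `ℒ*` on `U` (with an identity adjoined to `U`). -/
def LStarOn (mul : α → α → α) (U : Set α) (a b : α) : Prop :=
  (∀ x ∈ U, ∀ y ∈ U, (mul a x = mul a y ↔ mul b x = mul b y)) ∧
  (∀ x ∈ U, (mul a x = a ↔ mul b x = b))

/-- Green's relation `ℒ` on `U`: `U¹ a = U¹ b`. -/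
def GreenLOn (mul : α → α → α) (U : Set α) (a b : α) : Prop :=
  (a = b ∨ ∃ u ∈ U, mul u b = a) ∧ (b = a ∨ ∃ v ∈ U, mul v a = b)

/-- Green's relation `ℛ` on `U`: `a U¹ = b U¹`. -/
def GreenROn (mul : α → α → α) (U : Set α) (a b : α) : Prop :=
  (a = b ∨ ∃ u ∈ U, mul b u = a) ∧ (b = a ∨ ∃ v ∈ U, mul a v = b)

/-- `U` is closed under `mul`. -/
def ClosedOn (mul : α → α → α) (U : Set α) : Prop :=
  ∀ a ∈ U, ∀ b ∈ U, mul a b ∈ U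

/-- `U` with the operation `mul` is a semigroup. -/
def SemigroupOn (mul : α → α → α) (U : Set α) : Prop :=
  ClosedOn mul U ∧ ∀ a ∈ U, ∀ b ∈ U, ∀ c ∈ U, mul (mul a b) c = mul a (mul b c)

/-- Every `ℛ*`-class and every `ℒ*`-class of `U` contains an idempotent. -/
def AbundantOn (mul : α → α → α) (U : Set α) : Prop :=
  ∀ a ∈ U, (∃ e ∈ U, Idem mul e ∧ RStarOn mul U a e) ∧
           (∃ f ∈ U, Idem mul f ∧ LStarOn mul U a f)

/-- Abundant with commuting idempotents. -/
def AdequateOn (mul : α → α → α) (U : Set α) : Prop :=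
  AbundantOn mul U ∧
    ∀ u ∈ U, ∀ v ∈ U, Idem mul u → Idem mul v → mul u v = mul v u

/-- Abundant, and every `ℛ*`-class contains a unique idempotent. -/
def LeftAdequateOn (mul : α → α → α) (U : Set α) : Prop :=
  AbundantOn mul U ∧
    ∀ u ∈ U, ∀ v ∈ U, Idem mul u → Idem mul v → RStarOn mul U u v → u = v

/-- Abundant, and every `ℒ*`-class contains a unique idempotent. -/
def RightAdequateOn (mul : α → α → α) (U : Set α) : Prop :=
  AbundantOn mul U ∧
    ∀ u ∈ U, ∀ v ∈ U, Idem mul u → Idem mul v → LStarOn mul U u v → u = v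

/-- `S0` is a quasi-ideal of `U` : `S0 U S0 ⊆ S0`. -/
def QuasiIdealOn (mul : α → α → α) (U S0 : Set α) : Prop :=
  ∀ s ∈ S0, ∀ x ∈ U, ∀ t ∈ S0, mul (mul s x) t ∈ S0

/-- Every element of `U` has an inverse in `U`. -/
def RegularOn (mul : α → α → α) (U : Set α) : Prop :=
  ∀ x ∈ U, ∃ u ∈ U, mul (mul x u) x = x ∧ mul (mul u x) u = u

/-- Regular with commuting idempotents, i.e. an inverse semigroup. -/
def InverseSgpOn (mul : α → α → α) (U : Set α) : Prop :=
  RegularOn mul U ∧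
    ∀ u ∈ U, ∀ v ∈ U, Idem mul u → Idem mul v → mul u v = mul v u

/-- Regular, and every Green `ℛ`-class contains a unique idempotent. -/
def LeftInverseSgpOn (mul : α → α → α) (U : Set α) : Prop :=
  RegularOn mul U ∧
    ∀ u ∈ U, ∀ v ∈ U, Idem mul u → Idem mul v → GreenROn mul U u v → u = v

/-- Regular, and every Green `ℒ`-class contains a unique idempotent. -/
def RightInverseSgpOn (mul : α → α → α) (U : Set α) : Prop :=
  RegularOn mul U ∧
    ∀ u ∈ U, ∀ v ∈ U, Idem mul u → Idem mul v → GreenLOn mul U u v → u = v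

/-- An isomorphism from `(A, mulA)` onto `(B, mulB)`. -/
def IsoOn (mulA : α → α → α) (mulB : β → β → β) (A : Set α) (B : Set β) : Prop :=
  ∃ θ : α → β, Set.BijOn θ A B ∧ ∀ a ∈ A, ∀ b ∈ A, θ (mulA a b) = mulB (θ a) (θ b)

/-- `S0` is an adequate transversal of the abundant semigroup `U`.  `S0` is an
adequate `*`-subsemigroup of `U` (witnessed by `plus`/`star`, the canonical
idempotents `a⁺ ℛ* a`, `a⋆ ℒ* a` of elements of `S0`, the `ℛ*`/`ℒ*` relations
being those of the big semigroup `U`, which gives the `*`-subsemigroup property),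
and every `x ∈ U` factors uniquely as `x = e_x x̄ f_x` with `x̄ ∈ S0`,
`e_x, f_x` idempotents of `U`, `e_x ℒ x̄⁺` and `f_x ℛ x̄⋆`. -/
structure AdequateTransversalOn (mul : α → α → α) (U S0 : Set α) where
  sub : S0 ⊆ U
  mul_mem : ∀ a ∈ S0, ∀ b ∈ S0, mul a b ∈ S0
  bar : α → α
  e : α → α
  f : α → α
  plus : α → α
  star : α → α
  plus_mem : ∀ a ∈ S0, plus a ∈ S0
  plus_idem : ∀ a ∈ S0, Idem mul (plus a)
  plus_rstar : ∀ a ∈ S0, RStarOn mul U a (plus a)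
  star_mem : ∀ a ∈ S0, star a ∈ S0
  star_idem : ∀ a ∈ S0, Idem mul (star a)
  star_lstar : ∀ a ∈ S0, LStarOn mul U a (star a)
  idem_comm : ∀ u ∈ S0, ∀ v ∈ S0, Idem mul u → Idem mul v → mul u v = mul v u
  bar_mem : ∀ x ∈ U, bar x ∈ S0
  e_mem : ∀ x ∈ U, e x ∈ U
  f_mem : ∀ x ∈ U, f x ∈ U
  e_idem : ∀ x ∈ U, Idem mul (e x)
  f_idem : ∀ x ∈ U, Idem mul (f x)
  decomp : ∀ x ∈ U, x = mul (mul (e x) (bar x)) (f x)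
  e_greenL : ∀ x ∈ U, GreenLOn mul U (e x) (plus (bar x))
  f_greenR : ∀ x ∈ U, GreenROn mul U (f x) (star (bar x))
  unique : ∀ x ∈ U, ∀ s ∈ S0, ∀ e' ∈ U, ∀ f' ∈ U, Idem mul e' → Idem mul f' →
      x = mul (mul e' s) f' → GreenLOn mul U e' (plus s) → GreenROn mul U f' (star s) →
      s = bar x ∧ e' = e x ∧ f' = f x

namespace AdequateTransversalOn

variable {mul : α → α → α} {U S0 : Set α}

/-- `R = {x ∈ U : e_x = e_{x̄}}`. -/
def Rset (T : AdequateTransversalOn mul U S0) : Set α :=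
  {x | x ∈ U ∧ T.e x = T.e (T.bar x)}

/-- `L = {x ∈ U : f_x = f_{x̄}}`. -/
def Lset (T : AdequateTransversalOn mul U S0) : Set α :=
  {x | x ∈ U ∧ T.f x = T.f (T.bar x)}

/-- `I = {e_x : x ∈ U}`. -/
def Iset (T : AdequateTransversalOn mul U S0) : Set α :=
  {y | ∃ x ∈ U, T.e x = y}

/-- `Λ = {f_x : x ∈ U}`. -/
def LamSet (T : AdequateTransversalOn mul U S0) : Set α :=
  {y | ∃ x ∈ U, T.f x = y}

/-- The transversal is multiplicative: `Λ I ⊆ E⁰`. -/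
def IsMultiplicative (T : AdequateTransversalOn mul U S0) : Prop :=
  ∀ l ∈ T.LamSet, ∀ i ∈ T.Iset, mul l i ∈ S0 ∧ Idem mul (mul l i)

end AdequateTransversalOn

/-- The spined product set `T = L |×| R ⊆ S × S` attached to an adequate
transversal of `S` (ambient carrier `U`). -/
def spSet {mul : α → α → α} {U S0 : Set α}
    (T : AdequateTransversalOn mul U S0) : Set (α × α) :=
  {p | p.1 ∈ T.Lset ∧ p.2 ∈ T.Rset ∧ T.bar p.1 = T.bar p.2}

/-- The multiplication `(x,a)(y,b) = (e_x(ay), (ay) f_b)` on the spined product. -/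
def spMul {mul : α → α → α} {U S0 : Set α}
    (T : AdequateTransversalOn mul U S0) : α × α → α × α → α × α :=
  fun p q => (mul (T.e p.1) (mul p.2 q.1), mul (mul p.2 q.1) (T.f q.2))

/-- The map `φ : S → T`, `x ↦ (e_x x̄, x̄ f_x)`. -/
def phiMap {mul : α → α → α} {U S0 : Set α}
    (T : AdequateTransversalOn mul U S0) : α → α × α :=
  fun x => (mul (T.e x) (T.bar x), mul (T.bar x) (T.f x))

/-- `T⁰ = {(s,s) : s ∈ S0}`. -/
def diagSet (S0 : Set α) : Set (α × α) := {p | ∃ s ∈ S0, p = (s, s)}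

/-- Abstract spined product `L |×| R` over a common transversal `S⁰` (a type `γ`
embedded into `L` and `R` by `jL`, `jR`). -/
def absTset {mulL : α → α → α} {mulR : β → β → β} {jL : γ → α} {jR : γ → β}
    (TL : AdequateTransversalOn mulL Set.univ (Set.range jL))
    (TR : AdequateTransversalOn mulR Set.univ (Set.range jR)) : Set (α × β) :=
  {p | ∃ s : γ, jL s = TL.bar p.1 ∧ jR s = TR.bar p.2}

/-- The multiplication `(x,a)(y,b) = (e_x(a∗y), (a∗y) f_b)`. -/
def absMul {mulL : α → α → α} {mulR : β → β → β} {jL : γ → α} {jR : γ → β}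
    (TL : AdequateTransversalOn mulL Set.univ (Set.range jL))
    (TR : AdequateTransversalOn mulR Set.univ (Set.range jR))
    (st : β → α → γ) : α × β → α × β → α × β :=
  fun p q => (mulL (TL.e p.1) (jL (st p.2 q.1)), mulR (jR (st p.2 q.1)) (TR.f q.2))

/-- `T⁰ = {(s,s) : s ∈ S⁰}` inside `L × R`, where `s` is viewed in `L` and in `R`. -/
def absT0 (jL : γ → α) (jR : γ → β) : Set (α × β) :=
  {p | ∃ s : γ, p = (jL s, jR s)}

/-- `S0` is an inverse transversal of the regular semigroup `U`: an inverse
subsemigroup meeting the set of inverses of each `x ∈ U` in exactly one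
element `o x = x⁰`. -/
structure InverseTransversalOn (mul : α → α → α) (U S0 : Set α) where
  sub : S0 ⊆ U
  mul_mem : ∀ a ∈ S0, ∀ b ∈ S0, mul a b ∈ S0
  o : α → α
  o_mem : ∀ x ∈ U, o x ∈ S0
  o_inv1 : ∀ x ∈ U, mul (mul x (o x)) x = x
  o_inv2 : ∀ x ∈ U, mul (mul (o x) x) (o x) = o x
  o_unique : ∀ x ∈ U, ∀ u ∈ S0, mul (mul x u) x = x → mul (mul u x) u = u → u = o x
  idem_comm : ∀ u ∈ S0, ∀ v ∈ S0, Idem mul u → Idem mul v → mul u v = mul v u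

namespace InverseTransversalOn

variable {mul : α → α → α} {U S0 : Set α}

/-- `L = {x ∈ U : x⁰x ∈ E⁰}`. -/
def LsetI (T : InverseTransversalOn mul U S0) : Set α :=
  {x | x ∈ U ∧ mul (T.o x) x ∈ S0 ∧ Idem mul (mul (T.o x) x)}

/-- `R = {x ∈ U : xx⁰ ∈ E⁰}`. -/
def RsetI (T : InverseTransversalOn mul U S0) : Set α :=
  {x | x ∈ U ∧ mul x (T.o x) ∈ S0 ∧ Idem mul (mul x (T.o x))}

end InverseTransversalOn

/-- Spined product set for an inverse transversal: `{(x,a) : x⁰ = a⁰}`. -/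
def invSpSet {mul : α → α → α} {U S0 : Set α}
    (T : InverseTransversalOn mul U S0) : Set (α × α) :=
  {p | p.1 ∈ T.LsetI ∧ p.2 ∈ T.RsetI ∧ T.o p.1 = T.o p.2}

/-- The multiplication `(x,a)(y,b) = ((xx⁰)(ay), (ay)(b⁰b))`. -/
def invSpMul {mul : α → α → α} {U S0 : Set α}
    (T : InverseTransversalOn mul U S0) : α × α → α × α → α × α :=
  fun p q => (mul (mul p.1 (T.o p.1)) (mul p.2 q.1),
              mul (mul p.2 q.1) (mul (T.o q.2) q.2))

/-- Abstract spined product for inverse transversals: `{(x,a) : x⁰ = a⁰}`. -/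
def invAbsTset {mulL : α → α → α} {mulR : β → β → β} {jL : γ → α} {jR : γ → β}
    (TL : InverseTransversalOn mulL Set.univ (Set.range jL))
    (TR : InverseTransversalOn mulR Set.univ (Set.range jR)) : Set (α × β) :=
  {p | ∃ s : γ, jL s = TL.o p.1 ∧ jR s = TR.o p.2}

/-- The multiplication `(x,a)(y,b) = ((xx⁰)(a∗y), (a∗y)(b⁰b))`. -/
def invAbsMul {mulL : α → α → α} {mulR : β → β → β} {jL : γ → α} {jR : γ → β}
    (TL : InverseTransversalOn mulL Set.univ (Set.range jL))
    (TR : InverseTransversalOn mulR Set.univ (Set.range jR))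
    (st : β → α → γ) : α × β → α × β → α × β :=
  fun p q => (mulL (mulL p.1 (TL.o p.1)) (jL (st p.2 q.1)),
              mulR (jR (st p.2 q.1)) (mulR (TR.o q.2) q.2))

/-- The multiplication `(e,x)(g,w) = (e(aa⁻¹), a)`, `a = x((x⁻¹x)g)w`, on `I × S⁰`
(Chen-style construction from a left normal band `I` with semilattice transversal
`E⁰ = E(S⁰)`; `σ` embeds idempotents of the inverse semigroup `γ` into the band
`β`, and `π : β → γ` is the semilattice-transversal map `e ↦ e⁰`). -/
def bandMul (mulB : β → β → β) (mulG : γ → γ → γ) (σ : γ → β) (π : β → γ)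
    (inv : γ → γ) (p q : β × γ) : β × γ :=
  let a := mulG (mulG p.2 (π (mulB (σ (mulG (inv p.2) p.2)) q.1))) q.2
  (mulB p.1 (σ (mulG a (inv a))), a)

/-- `T = {(e,x) : e⁰ = xx⁻¹}`. -/
def bandTset (mulG : γ → γ → γ) (π : β → γ) (inv : γ → γ) : Set (β × γ) :=
  {p | π p.1 = mulG p.2 (inv p.2)}

/-- `T⁰ = {(aa⁻¹, a) : a ∈ S⁰}` (with `aa⁻¹` viewed in the band via `σ`). -/
def bandT0 (mulG : γ → γ → γ) (σ : γ → β) (inv : γ → γ) : Set (β × γ) :=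
  {p | ∃ s : γ, p = (σ (mulG s (inv s)), s)}

end Paper

namespace Paper

/-- `inv` is an inversion on the semigroup `G`, whose idempotents commute. -/
structure IsInversion {G : Type*} [Semigroup G] (inv : G → G) : Prop where
  mul_inv_mul : ∀ s : G, s * inv s * s = s
  inv_mul_inv : ∀ s : G, inv s * s * inv s = inv s
  idem_comm : ∀ s t : G, s * s = s → t * t = t → s * t = t * s

namespace IsInversion

variable {G : Type*} [Semigroup G] {inv : G → G}

theorem eq_inv (h : IsInversion inv) {s u : G} (h₁ : s * u * s = s) (h₂ : u * s * u = u) :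
    u = inv s := by
  have h₃ := h.mul_inv_mul s
  have h₄ := h.inv_mul_inv s
  have h₅ := h.idem_comm (s * u) (s * inv s) (by grind) (by grind)
  have h₆ := h.idem_comm (u * s) (inv s * s) (by grind) (by grind)
  grind

theorem mul_inv_idem (h : IsInversion inv) (s : G) :
    (s * inv s) * (s * inv s) = s * inv s := by
  rw [← mul_assoc, h.mul_inv_mul]

theorem inv_mul_idem (h : IsInversion inv) (s : G) :
    (inv s * s) * (inv s * s) = inv s * s := by
  rw [← mul_assoc, h.inv_mul_inv]

theorem inv_of_idem (h : IsInversion inv) {s : G} (hs : s * s = s) : inv s = s :=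
  (h.eq_inv (by rw [hs, hs]) (by rw [hs, hs])).symm

theorem mul_idem (h : IsInversion inv) {s t : G} (hs : s * s = s) (ht : t * t = t) :
    (s * t) * (s * t) = s * t := by
  have := h.idem_comm s t hs ht
  grind

theorem range_mul_range (h : IsInversion inv) (s t : G) :
    s * inv s * (s * t * inv (s * t)) = s * t * inv (s * t) := by
  have := h.mul_inv_mul s
  grind

end IsInversion

/-- The semilattice of idempotents of the inverse semigroup `G`, embedded by `σ` into the left
normal band `B`, is a semilattice transversal of `B` with transversal map `π`. -/
structure IsBandTransversal {B G : Type*} [Semigroup B] [Semigroup G]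
    (inv : G → G) (σ : G → B) (π : B → G) : Prop extends IsInversion inv where
  band : ∀ e : B, e * e = e
  leftNormal : ∀ e f g : B, e * f * g = e * g * f
  map_mul : ∀ s t : G, s * s = s → t * t = t → σ (s * t) = σ s * σ t
  proj_map : ∀ s : G, s * s = s → π (σ s) = s
  proj_idem : ∀ e : B, π e * π e = π e
  mul_proj : ∀ e : B, e * σ (π e) = e
  proj_mul : ∀ e : B, σ (π e) * e = σ (π e)
  eq_proj : ∀ (e : B) (s : G), s * s = s → e * σ s = e → σ s * e = σ s → s = π e

namespace IsBandTransversal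

variable {B G : Type*} [Semigroup B] [Semigroup G] {inv : G → G} {σ : G → B} {π : B → G}

theorem map_mul_eq (h : IsBandTransversal inv σ π) {s : G} (hs : s * s = s) (e : B) :
    σ s * e = σ (s * π e) := by
  rw [h.map_mul _ _ hs (h.proj_idem e)]
  calc σ s * e = σ s * (e * σ (π e)) := by rw [h.mul_proj]
    _ = σ s * σ (π e) * e := by rw [← mul_assoc, h.leftNormal]
    _ = σ s * σ (π e) := by rw [mul_assoc, h.proj_mul]

theorem proj_map_mul (h : IsBandTransversal inv σ π) {s : G} (hs : s * s = s) (e : B) :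
    π (σ s * e) = s * π e := by
  rw [h.map_mul_eq hs, h.proj_map _ (h.mul_idem hs (h.proj_idem e))]

theorem proj_mul_map (h : IsBandTransversal inv σ π) {s : G} (hs : s * s = s) (e : B) :
    π (e * σ s) = π e * s := by
  symm
  have h₁ := h.mul_proj e
  have h₂ := h.proj_mul e
  have h₃ := h.band (σ s)
  have h₄ := h.leftNormal e (σ s) (σ (π e))
  have h₅ := h.leftNormal (σ (π e)) (σ s) e
  refine h.eq_proj _ _ (h.mul_idem (h.proj_idem e) hs) ?_ ?_ <;>
    rw [h.map_mul _ _ (h.proj_idem e) hs] <;> grind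

theorem bandMul_eq (h : IsBandTransversal inv σ π) {p q : B × G}
    (hq : q ∈ bandTset (mulOf G) π inv) :
    bandMul (mulOf B) (mulOf G) σ π inv p q =
      (p.1 * σ (p.2 * q.2 * inv (p.2 * q.2)), p.2 * q.2) := by
  have hq' : π q.1 = q.2 * inv q.2 := hq
  have key : p.2 * π (σ (inv p.2 * p.2) * q.1) * q.2 = p.2 * q.2 := by
    rw [h.proj_map_mul (h.inv_mul_idem _), hq']
    have h₁ := h.mul_inv_mul p.2
    have h₂ := h.mul_inv_mul q.2
    grind
  simp only [bandMul, mulOf, key]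

theorem bandMul_mem (h : IsBandTransversal inv σ π) {p q : B × G}
    (hp : p ∈ bandTset (mulOf G) π inv) (hq : q ∈ bandTset (mulOf G) π inv) :
    bandMul (mulOf B) (mulOf G) σ π inv p q ∈ bandTset (mulOf G) π inv := by
  have hp' : π p.1 = p.2 * inv p.2 := hp
  rw [h.bandMul_eq hq]
  change π (p.1 * σ _) = p.2 * q.2 * inv (p.2 * q.2)
  rw [h.proj_mul_map (h.mul_inv_idem _), hp', h.range_mul_range]

theorem map_mem (h : IsBandTransversal inv σ π) (s : G) :
    (σ (s * inv s), s) ∈ bandTset (mulOf G) π inv :=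
  h.proj_map _ (h.mul_inv_idem s)

theorem fst_mul_map (h : IsBandTransversal inv σ π) {p : B × G}
    (hp : p ∈ bandTset (mulOf G) π inv) : p.1 * σ (p.2 * inv p.2) = p.1 := by
  have hp' : π p.1 = p.2 * inv p.2 := hp
  rw [← hp', h.mul_proj]

theorem map_range_mul (h : IsBandTransversal inv σ π) (s t : G) :
    σ (s * inv s) * σ (s * t * inv (s * t)) = σ (s * t * inv (s * t)) := by
  rw [← h.map_mul _ _ (h.mul_inv_idem _) (h.mul_inv_idem _), h.range_mul_range]

theorem bandMul_map (h : IsBandTransversal inv σ π) (s t : G) :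
    bandMul (mulOf B) (mulOf G) σ π inv (σ (s * inv s), s) (σ (t * inv t), t) =
      (σ (s * t * inv (s * t)), s * t) := by
  rw [h.bandMul_eq (h.map_mem t), h.map_range_mul]

theorem semigroupOn (h : IsBandTransversal inv σ π) :
    SemigroupOn (bandMul (mulOf B) (mulOf G) σ π inv) (bandTset (mulOf G) π inv) := by
  refine ⟨fun a ha b hb => h.bandMul_mem ha hb, fun a ha b hb c hc => ?_⟩
  rw [h.bandMul_eq hc, h.bandMul_eq (h.bandMul_mem hb hc), h.bandMul_eq hb, h.bandMul_eq hc]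
  simp only [mul_assoc a.1, h.map_range_mul, ← mul_assoc a.2]

theorem mul_inverse_mul (h : IsBandTransversal inv σ π) {p : B × G}
    (hp : p ∈ bandTset (mulOf G) π inv) :
    bandMul (mulOf B) (mulOf G) σ π inv (bandMul (mulOf B) (mulOf G) σ π inv p
      (σ (inv p.2 * inv (inv p.2)), inv p.2)) p = p := by
  rw [h.bandMul_eq hp, h.bandMul_eq (h.map_mem _)]
  simp only [h.inv_of_idem (h.mul_inv_idem p.2), h.mul_inv_idem, h.fst_mul_map hp, h.mul_inv_mul]

theorem inverse_mul_inverse (h : IsBandTransversal inv σ π) {p : B × G}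
    (hp : p ∈ bandTset (mulOf G) π inv) :
    bandMul (mulOf B) (mulOf G) σ π inv (bandMul (mulOf B) (mulOf G) σ π inv
      (σ (inv p.2 * inv (inv p.2)), inv p.2) p) (σ (inv p.2 * inv (inv p.2)), inv p.2) =
      (σ (inv p.2 * inv (inv p.2)), inv p.2) := by
  rw [h.bandMul_eq (h.map_mem _), h.bandMul_eq hp]
  simp only [h.map_range_mul]
  rw [h.inv_mul_inv]

/-- `ℛ`-related idempotents of the construction agree. -/
theorem eq_of_greenR (h : IsBandTransversal inv σ π) {p q : B × G}
    (hp : p ∈ bandTset (mulOf G) π inv) (hq : q ∈ bandTset (mulOf G) π inv)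
    (hpi : Idem (bandMul (mulOf B) (mulOf G) σ π inv) p)
    (hqi : Idem (bandMul (mulOf B) (mulOf G) σ π inv) q)
    (hR : GreenROn (bandMul (mulOf B) (mulOf G) σ π inv) (bandTset (mulOf G) π inv) p q) :
    p = q := by
  obtain ⟨hpq | ⟨u, hu, hup⟩, hqp | ⟨v, hv, hvq⟩⟩ := hR
  · exact hpq
  · exact hpq
  · exact hqp.symm
  unfold Idem at hpi hqi
  rw [h.bandMul_eq hp] at hpi
  rw [h.bandMul_eq hq] at hqi
  rw [h.bandMul_eq hu] at hup
  rw [h.bandMul_eq hv] at hvq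
  have hp₂ : p.2 * p.2 = p.2 := congrArg Prod.snd hpi
  have hq₂ : q.2 * q.2 = q.2 := congrArg Prod.snd hqi
  have hu₂ : q.2 * u.2 = p.2 := congrArg Prod.snd hup
  have hv₂ : p.2 * v.2 = q.2 := congrArg Prod.snd hvq
  have hu₁ : q.1 * σ (q.2 * u.2 * inv (q.2 * u.2)) = p.1 := congrArg Prod.fst hup
  have hcomm := h.idem_comm _ _ hp₂ hq₂
  have h₂ : p.2 = q.2 := by grind
  refine Prod.ext ?_ h₂
  rw [← hu₁, hu₂, h₂, h.fst_mul_map hq]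

theorem leftInverseSgpOn (h : IsBandTransversal inv σ π) :
    LeftInverseSgpOn (bandMul (mulOf B) (mulOf G) σ π inv) (bandTset (mulOf G) π inv) :=
  ⟨fun _ hp => ⟨_, h.map_mem _, h.mul_inverse_mul hp, h.inverse_mul_inverse hp⟩,
    fun _ hp _ hq => h.eq_of_greenR hp hq⟩

theorem nonempty_inverseTransversalOn (h : IsBandTransversal inv σ π) :
    Nonempty (InverseTransversalOn (bandMul (mulOf B) (mulOf G) σ π inv)
      (bandTset (mulOf G) π inv) (bandT0 (mulOf G) σ inv)) := by
  refine ⟨{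
    sub := ?_
    mul_mem := ?_
    o := fun p => (σ (inv p.2 * inv (inv p.2)), inv p.2)
    o_mem := fun p _ => ⟨inv p.2, rfl⟩
    o_inv1 := fun p hp => h.mul_inverse_mul hp
    o_inv2 := fun p hp => h.inverse_mul_inverse hp
    o_unique := ?_
    idem_comm := ?_ }⟩
  · rintro _ ⟨s, rfl⟩
    exact h.map_mem s
  · rintro _ ⟨s, rfl⟩ _ ⟨t, rfl⟩
    exact ⟨s * t, h.bandMul_map s t⟩
  · rintro p hp _ ⟨s, rfl⟩ h₁ h₂
    simp only [mulOf] at h₁ h₂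
    rw [h.bandMul_eq hp, h.bandMul_eq (h.map_mem s)] at h₁
    rw [h.bandMul_eq (h.map_mem s), h.bandMul_eq hp] at h₂
    have hs : s = inv p.2 := h.eq_inv (congrArg Prod.snd h₁) (congrArg Prod.snd h₂)
    simp only [mulOf, ← hs]
  · rintro _ ⟨s, rfl⟩ _ ⟨t, rfl⟩ hs ht
    simp only [Idem, mulOf, h.bandMul_map] at hs ht ⊢
    rw [h.idem_comm s t (congrArg Prod.snd hs) (congrArg Prod.snd ht)]

theorem quasiIdealOn (h : IsBandTransversal inv σ π) :
    QuasiIdealOn (bandMul (mulOf B) (mulOf G) σ π inv)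
      (bandTset (mulOf G) π inv) (bandT0 (mulOf G) σ inv) := by
  rintro _ ⟨s, rfl⟩ p hp _ ⟨t, rfl⟩
  refine ⟨s * p.2 * t, ?_⟩
  simp only [mulOf]
  rw [h.bandMul_eq (h.map_mem t), h.bandMul_eq hp]
  simp only [h.map_range_mul]

theorem isoOn_bandT0 (h : IsBandTransversal inv σ π) :
    IsoOn (mulOf G) (bandMul (mulOf B) (mulOf G) σ π inv)
      Set.univ (bandT0 (mulOf G) σ inv) := by
  refine ⟨fun s => (σ (s * inv s), s), ⟨fun s _ => ⟨s, rfl⟩, fun s _ t _ hst => ?_, ?_⟩,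
    fun s _ t _ => (h.bandMul_map s t).symm⟩
  · exact congrArg Prod.snd hst
  · rintro _ ⟨s, rfl⟩
    exact ⟨s, Set.mem_univ s, rfl⟩

end IsBandTransversal

section LeftInverse

variable {S : Type*} [Semigroup S]

theorem LeftInverseSgpOn.eq_of_mul_eq (hL : LeftInverseSgpOn (mulOf S) Set.univ) {e f : S}
    (he : e * e = e) (hf : f * f = f) {u v : S} (hu : f * u = e) (hv : e * v = f) : e = f :=
  hL.2 e (Set.mem_univ e) f (Set.mem_univ f) he hf
    ⟨Or.inr ⟨u, Set.mem_univ u, hu⟩, Or.inr ⟨v, Set.mem_univ v, hv⟩⟩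

theorem LeftInverseSgpOn.idem_mul (hL : LeftInverseSgpOn (mulOf S) Set.univ) {e f : S}
    (he : e * e = e) (hf : f * f = f) : (e * f) * (e * f) = e * f := by
  obtain ⟨u, -, hu₁, hu₂⟩ := hL.1 (e * f) (Set.mem_univ _)
  simp only [mulOf] at hu₁ hu₂
  obtain ⟨x, hx⟩ : ∃ x, x = f * u * e := ⟨_, rfl⟩
  have hx₁ : x * x = x := by grind
  have hfx : f * x = x := by grind
  have hxe : x * e = x := by grind
  have hefx : e * f * x * (e * f) = e * f := by grind
  have hxf : x * f = x :=
    hL.eq_of_mul_eq (u := f) (v := x) (by grind) hx₁ rfl (by grind)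
  grind

theorem LeftInverseSgpOn.idem_mul_mul (hL : LeftInverseSgpOn (mulOf S) Set.univ) {e f : S}
    (he : e * e = e) (hf : f * f = f) : e * f * e = e * f := by
  have hef := hL.idem_mul he hf
  exact hL.eq_of_mul_eq (u := e) (v := f) (by grind) hef rfl (by grind)

variable {S0 : Set S}

namespace InverseTransversalOn

theorem mul_o_mul (T : InverseTransversalOn (mulOf S) Set.univ S0) (x : S) :
    x * T.o x * x = x := T.o_inv1 x (Set.mem_univ x)

theorem o_mul_o (T : InverseTransversalOn (mulOf S) Set.univ S0) (x : S) :
    T.o x * x * T.o x = T.o x := T.o_inv2 x (Set.mem_univ x)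

theorem eq_o (T : InverseTransversalOn (mulOf S) Set.univ S0) {x u : S} (hu : u ∈ S0)
    (h₁ : x * u * x = x) (h₂ : u * x * u = u) : u = T.o x :=
  T.o_unique x (Set.mem_univ x) u hu h₁ h₂

theorem o_mem' (T : InverseTransversalOn (mulOf S) Set.univ S0) (x : S) : T.o x ∈ S0 :=
  T.o_mem x (Set.mem_univ x)

theorem o_o (T : InverseTransversalOn (mulOf S) Set.univ S0) {s : S} (hs : s ∈ S0) :
    T.o (T.o s) = s :=
  (T.eq_o hs (T.o_mul_o s) (T.mul_o_mul s)).symm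

theorem o_idem (T : InverseTransversalOn (mulOf S) Set.univ S0) {s : S} (hs : s ∈ S0)
    (hss : s * s = s) : T.o s = s :=
  (T.eq_o hs (by rw [hss, hss]) (by rw [hss, hss])).symm

theorem mul_o_idem (T : InverseTransversalOn (mulOf S) Set.univ S0) (x : S) :
    (x * T.o x) * (x * T.o x) = x * T.o x := by
  rw [← mul_assoc, T.mul_o_mul]

theorem o_mul_idem (T : InverseTransversalOn (mulOf S) Set.univ S0) (x : S) :
    (T.o x * x) * (T.o x * x) = T.o x * x := by
  rw [← mul_assoc, T.o_mul_o]

theorem o_mul_self (T : InverseTransversalOn (mulOf S) Set.univ S0)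
    (hL : LeftInverseSgpOn (mulOf S) Set.univ) (x : S) : T.o x * x = T.o x * T.o (T.o x) := by
  have h₁ := T.mul_o_mul (T.o x)
  have h₂ := T.o_mul_o x
  exact hL.eq_of_mul_eq (T.o_mul_idem x) (T.mul_o_idem _) (u := T.o x * x)
    (v := T.o x * T.o (T.o x)) (by grind) (by grind)

theorem o_mul_rev (T : InverseTransversalOn (mulOf S) Set.univ S0)
    (hL : LeftInverseSgpOn (mulOf S) Set.univ) (x y : S) : T.o (x * y) = T.o y * T.o x := by
  have h₁ := T.mul_o_mul x
  have h₂ := T.o_mul_o x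
  have h₃ := T.mul_o_mul y
  have h₄ := T.o_mul_o y
  have h₅ := hL.idem_mul (T.o_mul_idem x) (T.mul_o_idem y)
  have h₆ := hL.idem_mul (T.mul_o_idem y) (T.o_mul_idem x)
  refine (T.eq_o (T.mul_mem _ (T.o_mem' y) _ (T.o_mem' x)) ?_ ?_).symm
  · calc x * y * (T.o y * T.o x) * (x * y)
        = (x * T.o x * x) * (y * T.o y) * (T.o x * x) * (y * T.o y * y) := by
          rw [h₁, h₃]; simp only [mul_assoc]
      _ = x * (T.o x * x * (y * T.o y) * (T.o x * x * (y * T.o y))) * y := by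
          simp only [mul_assoc]
      _ = (x * T.o x * x) * (y * T.o y * y) := by rw [h₅]; simp only [mul_assoc]
      _ = x * y := by rw [h₁, h₃]
  · calc T.o y * T.o x * (x * y) * (T.o y * T.o x)
        = (T.o y * y * T.o y) * (T.o x * x) * (y * T.o y) * (T.o x * x * T.o x) := by
          rw [h₂, h₄]; simp only [mul_assoc]
      _ = T.o y * (y * T.o y * (T.o x * x) * (y * T.o y * (T.o x * x))) * T.o x := by
          simp only [mul_assoc]
      _ = (T.o y * y * T.o y) * (T.o x * x * T.o x) := by rw [h₆]; simp only [mul_assoc]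
      _ = T.o y * T.o x := by rw [h₂, h₄]

theorem idem_mul_o (T : InverseTransversalOn (mulOf S) Set.univ S0)
    (hL : LeftInverseSgpOn (mulOf S) Set.univ) {e : S} (he : e * e = e) : e * T.o e = e := by
  have h := T.mul_o_mul e
  exact hL.eq_of_mul_eq (T.mul_o_idem e) he (u := T.o e) (v := e) rfl h

theorem o_mul_of_idem (T : InverseTransversalOn (mulOf S) Set.univ S0)
    (hL : LeftInverseSgpOn (mulOf S) Set.univ) {e : S} (he : e * e = e) :
    T.o e * e = T.o e := by
  have h₁ := T.idem_mul_o hL he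
  have h₂ := T.o_mul_o e
  grind

theorem o_idem_of_idem (T : InverseTransversalOn (mulOf S) Set.univ S0)
    (hL : LeftInverseSgpOn (mulOf S) Set.univ) {e : S} (he : e * e = e) :
    T.o e * T.o e = T.o e := by
  have h₁ := T.o_mul_idem e
  rwa [T.o_mul_of_idem hL he] at h₁

theorem mul_eq_mul_o (T : InverseTransversalOn (mulOf S) Set.univ S0)
    (hL : LeftInverseSgpOn (mulOf S) Set.univ) (hQ : QuasiIdealOn (mulOf S) Set.univ S0)
    {h e : S} (hh : h ∈ S0) (hhi : h * h = h) (he : e * e = e) : h * e = h * T.o e := by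
  have h₁ := T.idem_mul_o hL he
  have h₂ := T.o_mul_of_idem hL he
  have h₃ := T.o_idem_of_idem hL he
  have h₄ := hL.idem_mul_mul hhi he
  have h₅ := hL.idem_mul hhi he
  have hmem : h * e ∈ S0 := h₄ ▸ hQ h hh e (Set.mem_univ e) h hh
  have h₆ : h * e * T.o e = T.o e * (h * e) := T.idem_comm _ hmem _ (T.o_mem' e) h₅ h₃
  have h₇ : h * T.o e = T.o e * h := T.idem_comm _ hh _ (T.o_mem' e) hhi h₃
  have h₈ := hL.idem_mul_mul h₃ hhi
  grind

theorem idem_leftNormal (T : InverseTransversalOn (mulOf S) Set.univ S0)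
    (hL : LeftInverseSgpOn (mulOf S) Set.univ) (hQ : QuasiIdealOn (mulOf S) Set.univ S0)
    {e f g : S} (he : e * e = e) (hf : f * f = f) (hg : g * g = g) :
    e * f * g = e * g * f := by
  have h₁ := T.idem_mul_o hL he
  have hcomm : T.o f * T.o g = T.o g * T.o f := T.idem_comm _ (T.o_mem' f) _ (T.o_mem' g)
    (T.o_idem_of_idem hL hf) (T.o_idem_of_idem hL hg)
  have key : ∀ {f g : S}, f * f = f → g * g = g → e * f * g = e * (T.o e * (T.o f * T.o g)) := by
    intro f g hf hg
    calc e * f * g = e * (T.o e * f) * g := by rw [← mul_assoc e, h₁]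
      _ = e * T.o e * (T.o f * g) := by
        rw [T.mul_eq_mul_o hL hQ (T.o_mem' e) (T.o_idem_of_idem hL he) hf]
        simp only [mul_assoc]
      _ = e * (T.o e * (T.o f * T.o g)) := by
        rw [T.mul_eq_mul_o hL hQ (T.o_mem' f) (T.o_idem_of_idem hL hf) hg, mul_assoc]
  rw [key hf hg, key hg hf, hcomm]

/-- The idempotents of a left inverse semigroup form a band. -/
abbrev idemSemigroup (hL : LeftInverseSgpOn (mulOf S) Set.univ) :
    Semigroup {e : S // e * e = e} where
  mul e f := ⟨e.1 * f.1, hL.idem_mul e.2 f.2⟩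
  mul_assoc e f g := Subtype.ext (mul_assoc e.1 f.1 g.1)

/-- An inverse transversal is a semigroup. -/
abbrev transversalSemigroup (T : InverseTransversalOn (mulOf S) Set.univ S0) :
    Semigroup S0 where
  mul s t := ⟨s.1 * t.1, T.mul_mem _ s.2 _ t.2⟩
  mul_assoc s t u := Subtype.ext (mul_assoc s.1 t.1 u.1)

theorem isBandTransversal (T : InverseTransversalOn (mulOf S) Set.univ S0)
    (hL : LeftInverseSgpOn (mulOf S) Set.univ) (hQ : QuasiIdealOn (mulOf S) Set.univ S0) :
    letI := idemSemigroup hL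
    letI := T.transversalSemigroup
    IsBandTransversal (B := {e : S // e * e = e}) (G := S0) (fun s => ⟨T.o s, T.o_mem' s⟩)
      (fun s => ⟨s * T.o s, T.mul_o_idem s⟩) (fun e => ⟨T.o e, T.o_mem' e⟩) := by
  let := idemSemigroup hL
  let := T.transversalSemigroup
  have hσ : ∀ s : S0, s * s = s → (s : S) * T.o s = s := fun s hs =>
    T.idem_mul_o hL (congrArg Subtype.val hs)
  have hcomm : ∀ s t : S0, s * s = s → t * t = t → s * t = t * s := fun s t hs ht =>
    Subtype.ext (T.idem_comm _ s.2 _ t.2 (congrArg Subtype.val hs) (congrArg Subtype.val ht))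
  exact {
    mul_inv_mul := fun s => Subtype.ext (T.mul_o_mul s)
    inv_mul_inv := fun s => Subtype.ext (T.o_mul_o s)
    idem_comm := hcomm
    band := fun e => Subtype.ext e.2
    leftNormal := fun e f g => Subtype.ext (T.idem_leftNormal hL hQ e.2 f.2 g.2)
    map_mul := fun s t hs ht => Subtype.ext <| by
      have hst : (s * t) * (s * t) = s * t := by
        have := hcomm s t hs ht
        grind
      exact (hσ _ hst).trans (congrArg₂ (· * ·) (hσ s hs).symm (hσ t ht).symm)
    proj_map := fun s hs => Subtype.ext <|
      (congrArg T.o (hσ s hs)).trans (T.o_idem s.2 (congrArg Subtype.val hs))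
    proj_idem := fun e => Subtype.ext (T.o_idem_of_idem hL e.2)
    mul_proj := fun e => Subtype.ext <|
      (congrArg (e.1 * ·) (T.idem_mul_o hL (T.o_idem_of_idem hL e.2))).trans
        (T.idem_mul_o hL e.2)
    proj_mul := fun e => Subtype.ext <| by
      have h := T.idem_mul_o hL (T.o_idem_of_idem hL e.2)
      exact (congrArg (· * e.1) h).trans ((T.o_mul_of_idem hL e.2).trans h.symm)
    eq_proj := fun e s hs h₁ h₂ => Subtype.ext <| by
      have h₁' : e.1 * (s.1 * T.o s) = e.1 := congrArg Subtype.val h₁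
      have h₂' : s.1 * T.o s * e.1 = s.1 * T.o s := congrArg Subtype.val h₂
      have hs' : s.1 * s.1 = s.1 := congrArg Subtype.val hs
      rw [hσ s hs] at h₁' h₂'
      exact T.eq_o s.2 (by rw [h₁', e.2]) (by rw [h₂', hs']) }

theorem isoOn_bandTset (T : InverseTransversalOn (mulOf S) Set.univ S0)
    (hL : LeftInverseSgpOn (mulOf S) Set.univ) (hQ : QuasiIdealOn (mulOf S) Set.univ S0) :
    letI := idemSemigroup hL
    letI := T.transversalSemigroup
    IsoOn (mulOf S) (bandMul (mulOf {e : S // e * e = e}) (mulOf S0)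
      (fun s => ⟨s * T.o s, T.mul_o_idem s⟩) (fun e => ⟨T.o e, T.o_mem' e⟩)
      (fun s => ⟨T.o s, T.o_mem' s⟩)) Set.univ
      (bandTset (mulOf S0) (fun e : {e : S // e * e = e} => ⟨T.o e, T.o_mem' e⟩)
        (fun s => ⟨T.o s, T.o_mem' s⟩)) := by
  let := idemSemigroup hL
  let := T.transversalSemigroup
  have h := T.isBandTransversal hL hQ
  have hfac : ∀ x : S, x * T.o x * T.o (T.o x) = x := fun x => by
    rw [mul_assoc, ← T.o_mul_self hL, ← mul_assoc, T.mul_o_mul]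
  have hmem : ∀ x : S, T.o (x * T.o x) = T.o (T.o x) * T.o (T.o (T.o x)) := fun x => by
    rw [T.o_mul_rev hL, T.o_o (T.o_mem' x)]
  refine ⟨fun x => (⟨x * T.o x, T.mul_o_idem x⟩, ⟨T.o (T.o x), T.o_mem' _⟩),
    ⟨fun x _ => Subtype.ext (hmem x), fun x _ y _ hxy => ?_, ?_⟩, fun x _ y _ => ?_⟩
  · have h₁ : x * T.o x = y * T.o y := congrArg (fun p => p.1.1) hxy
    have h₂ : T.o (T.o x) = T.o (T.o y) := congrArg (fun p => p.2.1) hxy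
    rw [← hfac x, ← hfac y, h₁, h₂]
  · rintro ⟨⟨e, he⟩, ⟨s, hs⟩⟩ hp
    have hp' : T.o e = s * T.o s := congrArg Subtype.val hp
    have ho : T.o (e * s) = T.o s := by
      rw [T.o_mul_rev hL, hp', ← mul_assoc, T.o_mul_o]
    refine ⟨e * s, Set.mem_univ _, Prod.ext (Subtype.ext ?_) (Subtype.ext ?_)⟩
    · simp only
      rw [ho, mul_assoc, ← hp', T.idem_mul_o hL he]
    · simp only
      rw [ho, T.o_o hs]
  · rw [h.bandMul_eq (Subtype.ext (hmem y))]
    have ho : T.o (T.o (x * y)) = T.o (T.o x) * T.o (T.o y) := by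
      rw [T.o_mul_rev hL, T.o_mul_rev hL]
    refine Prod.ext (Subtype.ext ?_) (Subtype.ext ho)
    change x * y * T.o (x * y) = x * T.o x * (T.o (T.o x) * T.o (T.o y) *
      T.o (T.o (T.o x) * T.o (T.o y)) * T.o (T.o (T.o x) * T.o (T.o y) *
      T.o (T.o (T.o x) * T.o (T.o y))))
    have hidem := T.mul_o_idem (T.o (T.o (x * y)))
    rw [← ho, T.idem_mul_o hL hidem, T.o_o (T.o_mem' (x * y)), ho, T.o_mul_rev hL]
    have hy := T.mul_eq_mul_o hL hQ (T.mul_mem _ (T.o_mem' x) _ (T.o_mem' (T.o x)))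
      (T.mul_o_idem (T.o x)) (T.mul_o_idem y)
    simp only [mulOf] at hy
    rw [hmem, T.o_o (T.o_mem' y)] at hy
    calc x * y * (T.o y * T.o x)
        = x * T.o x * T.o (T.o x) * y * (T.o y * T.o x) := by rw [hfac]
      _ = x * (T.o x * T.o (T.o x) * (y * T.o y)) * T.o x := by simp only [mul_assoc]
      _ = _ := by rw [hy]; simp only [mul_assoc]

end InverseTransversalOn

end LeftInverse

end Paper

open Paper in
/-- Let `S⁰` (the type `G`) be an inverse semigroup with
semilattice of idempotents `E⁰` and let `I` (the type `B`) be a left normal band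
containing `E⁰` as a subsemigroup and semilattice transversal: `σ` embeds the
idempotents of `G` into `B`, and `π : B → G` is the transversal map `e ↦ e⁰`
(so `e⁰ = σ (π e)` in `B`).  Then `T = {(e,x) : e⁰ = xx⁻¹}` with
`(e,x)(g,w) = (e(aa⁻¹), a)`, `a = x((x⁻¹x)g)w`, is a left inverse semigroup and
`T⁰ = {(aa⁻¹, a) : a ∈ S⁰}` is a quasi-ideal inverse transversal of `T`
isomorphic to `S⁰`.  Moreover every left inverse semigroup with a quasi-ideal
inverse transversal is isomorphic to one constructed in this way. -/
theorem stmt18 {B G : Type u} [Semigroup B] [Semigroup G]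
    (hG : InverseSgpOn (mulOf G) Set.univ)
    (inv : G → G)
    (hinv1 : ∀ s : G, s * inv s * s = s)
    (hinv2 : ∀ s : G, inv s * s * inv s = inv s)
    (hband : ∀ e : B, e * e = e)
    (hln : ∀ e f g : B, e * f * g = e * g * f)
    (σ : G → B) (π : B → G)
    (hσmul : ∀ s t : G, Idem (mulOf G) s → Idem (mulOf G) t →
      σ (s * t) = σ s * σ t)
    (hπσ : ∀ s : G, Idem (mulOf G) s → π (σ s) = s)
    (hπidem : ∀ e : B, Idem (mulOf G) (π e))
    (htr1 : ∀ e : B, e * σ (π e) = e)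
    (htr2 : ∀ e : B, σ (π e) * e = σ (π e))
    (htruniq : ∀ (e : B) (s : G), Idem (mulOf G) s →
      e * σ s = e → σ s * e = σ s → s = π e) :
    (SemigroupOn (bandMul (mulOf B) (mulOf G) σ π inv) (bandTset (mulOf G) π inv) ∧
     LeftInverseSgpOn (bandMul (mulOf B) (mulOf G) σ π inv) (bandTset (mulOf G) π inv) ∧
     Nonempty (InverseTransversalOn (bandMul (mulOf B) (mulOf G) σ π inv)
        (bandTset (mulOf G) π inv) (bandT0 (mulOf G) σ inv)) ∧
     QuasiIdealOn (bandMul (mulOf B) (mulOf G) σ π inv)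
        (bandTset (mulOf G) π inv) (bandT0 (mulOf G) σ inv) ∧
     IsoOn (mulOf G) (bandMul (mulOf B) (mulOf G) σ π inv)
        Set.univ (bandT0 (mulOf G) σ inv)) ∧
    (∀ (S : Type u) [Semigroup S] (S0 : Set S)
       (T : InverseTransversalOn (mulOf S) Set.univ S0),
       RegularOn (mulOf S) Set.univ →
       LeftInverseSgpOn (mulOf S) Set.univ →
       QuasiIdealOn (mulOf S) Set.univ S0 →
       ∃ (B' G' : Type u) (mulB : B' → B' → B') (mulG : G' → G' → G')
         (inv' : G' → G') (σ' : G' → B') (π' : B' → G'),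
         (∀ a b c : B', mulB (mulB a b) c = mulB a (mulB b c)) ∧
         (∀ a b c : G', mulG (mulG a b) c = mulG a (mulG b c)) ∧
         InverseSgpOn mulG Set.univ ∧
         (∀ s : G', mulG (mulG s (inv' s)) s = s) ∧
         (∀ s : G', mulG (mulG (inv' s) s) (inv' s) = inv' s) ∧
         (∀ e : B', mulB e e = e) ∧
         (∀ e f g : B', mulB (mulB e f) g = mulB (mulB e g) f) ∧
         (∀ s t : G', Idem mulG s → Idem mulG t →
           σ' (mulG s t) = mulB (σ' s) (σ' t)) ∧
         (∀ s : G', Idem mulG s → π' (σ' s) = s) ∧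
         (∀ e : B', Idem mulG (π' e)) ∧
         (∀ e : B', mulB e (σ' (π' e)) = e) ∧
         (∀ e : B', mulB (σ' (π' e)) e = σ' (π' e)) ∧
         (∀ (e : B') (s : G'), Idem mulG s →
           mulB e (σ' s) = e → mulB (σ' s) e = σ' s → s = π' e) ∧
         IsoOn (mulOf S) (bandMul mulB mulG σ' π' inv')
           Set.univ (bandTset mulG π' inv')) := by
  have h : IsBandTransversal inv σ π :=
    { mul_inv_mul := hinv1
      inv_mul_inv := hinv2
      idem_comm := fun s t => hG.2 s (Set.mem_univ s) t (Set.mem_univ t)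
      band := hband
      leftNormal := hln
      map_mul := hσmul
      proj_map := hπσ
      proj_idem := hπidem
      mul_proj := htr1
      proj_mul := htr2
      eq_proj := htruniq }
  refine ⟨⟨h.semigroupOn, h.leftInverseSgpOn, h.nonempty_inverseTransversalOn, h.quasiIdealOn,
    h.isoOn_bandT0⟩, ?_⟩
  intro S _ S0 T _ hL hQ
  let := InverseTransversalOn.idemSemigroup hL
  let := T.transversalSemigroup
  have hT := T.isBandTransversal hL hQ
  exact ⟨{e : S // e * e = e}, S0, mulOf _, mulOf _, fun s => ⟨T.o s, T.o_mem' s⟩,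
    fun s => ⟨s * T.o s, T.mul_o_idem s⟩, fun e => ⟨T.o e, T.o_mem' e⟩, mul_assoc, mul_assoc,
    ⟨fun s _ => ⟨_, Set.mem_univ _, hT.mul_inv_mul s, hT.inv_mul_inv s⟩,
      fun s _ t _ => hT.idem_comm s t⟩,
    hT.mul_inv_mul, hT.inv_mul_inv, hT.band, hT.leftNormal, hT.map_mul, hT.proj_map,
    hT.proj_idem, hT.mul_proj, hT.proj_mul, hT.eq_proj, T.isoOn_bandTset hL hQ⟩
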